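/- arXiv:1505.04635 — 2 statements merged into one kernel-verified Lean document; each statement's English description precedes it below -/
import Mathlib

section
/- Let E be an elliptic curve over a finite field F_q with q elements, and let K be a field extension of F_q of degree 2. Write N = |E(F_q)| for the number of F_q-rational points of E and N' = |E(K)| for the number of K-rational points of the base change of E to K. Then N' = N·(2q + 2 − N). -/
/-- A quadratic extension of a finite field has an involution whose fixed points are exactly the
elements of the base field. -/
theorem exists_involution_of_finrank_eq_two {F K : Type*} [Field F] [Finite F] [Field K]
    [Algebra F K] (hK : Module.finrank F K = 2) :
    ∃ σ : K →ₐ[F] K, (∀ x, σ (σ x) = x) ∧ ∀ x, σ x = x → ∃ a, algebraMap F K a = x := by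
  have : FiniteDimensional F K := Module.finite_of_finrank_pos (by omega)
  have : Finite K := Module.finite_of_finite F
  have hcard : Nat.card Gal(K/F) = 2 := (IsGalois.card_aut_eq_finrank F K).trans hK
  obtain ⟨σ, hσ, huniq⟩ := (Nat.card_eq_two_iff' (1 : Gal(K/F))).mp hcard
  refine ⟨σ, fun x ↦ ?_, fun x hx ↦ ?_⟩
  · have h : σ ^ 2 = 1 := hcard ▸ pow_card_eq_one'
    simpa [sq] using DFunLike.congr_fun h x
  · refine (IsGalois.mem_range_algebraMap_iff_fixed x).mpr fun τ ↦ ?_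
    by_cases hτ : τ = 1
    · simp [hτ]
    · rw [huniq τ hτ]
      exact hx

/-- Every monic quadratic polynomial over a finite field has a root in the quadratic extension. -/
theorem exists_root_of_finrank_eq_two {F K : Type*} [Field F] [Finite F] [Field K]
    [Algebra F K] (hK : Module.finrank F K = 2) (b c : F) :
    ∃ r : K, r ^ 2 + algebraMap F K b * r + algebraMap F K c = 0 := by
  have : FiniteDimensional F K := Module.finite_of_finrank_pos (by omega)
  have : Finite K := Module.finite_of_finite F
  by_cases hroot : ∃ a : F, a ^ 2 + b * a + c = 0
  · obtain ⟨a, ha⟩ := hroot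
    exact ⟨algebraMap F K a, by simpa using congrArg (algebraMap F K) ha⟩
  open Polynomial in
  let p : F[X] := C 1 * X ^ 2 + C b * X + C c
  have hdeg : p.natDegree = 2 := Polynomial.natDegree_quadratic one_ne_zero
  have hp0 : p ≠ 0 := Polynomial.ne_zero_of_natDegree_gt (n := 0) (by omega)
  have hirr : Irreducible p := by
    rw [Polynomial.irreducible_iff_roots_eq_zero_of_degree_le_three (by omega) (by omega)]
    refine Multiset.eq_zero_of_forall_notMem fun a ha ↦ hroot ⟨a, ?_⟩
    simpa [p] using (Polynomial.mem_roots'.mp ha).2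
  have := Fact.mk hirr
  have hfin : Module.finrank F (AdjoinRoot p) = 2 := by
    rw [(AdjoinRoot.powerBasis hp0).finrank, AdjoinRoot.powerBasis_dim, hdeg]
  have : FiniteDimensional F (AdjoinRoot p) := Module.finite_of_finrank_pos (by omega)
  have : Finite (AdjoinRoot p) := Module.finite_of_finite F
  obtain ⟨φ⟩ := FiniteField.nonempty_algHom_of_finrank_dvd (F := F) (K := AdjoinRoot p) (L := K)
    (by rw [hfin, hK])
  refine ⟨φ (AdjoinRoot.root p), ?_⟩
  have h : Polynomial.aeval (φ (AdjoinRoot.root p)) p = 0 := by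
    rw [Polynomial.aeval_algHom_apply]
    simp
  simpa [p] using h

/-- For a monic quadratic polynomial over `F`, the roots in `F` together with the roots in the
quadratic extension that the involution exchanges with their complementary root number two. -/
theorem ncard_roots_add_ncard_conjugate_roots {F K : Type*} [Field F] [Field K] [Algebra F K]
    {σ : K →ₐ[F] K} (hfix : ∀ x, σ x = x → ∃ a, algebraMap F K a = x) {b c : F}
    (hroot : ∃ r : K, r ^ 2 + algebraMap F K b * r + algebraMap F K c = 0) :
    {y : F | y ^ 2 + b * y + c = 0}.ncard +
      {y : K | y ^ 2 + algebraMap F K b * y + algebraMap F K c = 0 ∧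
        σ y = -algebraMap F K b - y}.ncard = 2 := by
  obtain ⟨r, hr⟩ := hroot
  have hinj := (algebraMap F K).injective
  have hroots (y : K) (hy : y ^ 2 + algebraMap F K b * y + algebraMap F K c = 0) :
      y = r ∨ y = -algebraMap F K b - r := by
    have : (y - r) * (y - (-algebraMap F K b - r)) = 0 := by linear_combination hy - hr
    simpa [sub_eq_zero] using this
  by_cases hσ : σ r = r
  · obtain ⟨a, rfl⟩ := hfix r hσ
    have hF : {y : F | y ^ 2 + b * y + c = 0} = {a, -b - a} := by
      have ha : a ^ 2 + b * a + c = 0 := hinj (by simpa using hr)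
      ext y
      simp only [Set.mem_ofPred_eq, Set.mem_insert_iff, Set.mem_singleton_iff]
      constructor
      · intro hy
        have : (y - a) * (y - (-b - a)) = 0 := by linear_combination hy - ha
        simpa [sub_eq_zero] using this
      · rintro (rfl | rfl)
        · exact ha
        · linear_combination ha
    by_cases hab : a = -b - a
    · have hab' : algebraMap F K a = -algebraMap F K b - algebraMap F K a := by
        simpa using congrArg (algebraMap F K) hab
      have hK : {y : K | y ^ 2 + algebraMap F K b * y + algebraMap F K c = 0 ∧
          σ y = -algebraMap F K b - y} = {algebraMap F K a} := by
        ext y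
        simp only [Set.mem_ofPred_eq, Set.mem_singleton_iff]
        constructor
        · rintro ⟨hy, -⟩
          rcases hroots y hy with h | h
          · exact h
          · exact h.trans hab'.symm
        · rintro rfl
          exact ⟨hr, hσ.trans hab'⟩
      rw [hF, hK, ← hab]
      simp
    · have hK : {y : K | y ^ 2 + algebraMap F K b * y + algebraMap F K c = 0 ∧
          σ y = -algebraMap F K b - y} = ∅ := by
        rw [Set.eq_empty_iff_forall_notMem]
        rintro y ⟨hy, hσy⟩
        apply hab
        apply hinj
        rcases hroots y hy with rfl | rfl
        · simpa using hσy
        · simpa using hσy.symm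
      rw [hF, hK, Set.ncard_pair hab, Set.ncard_empty]
  · have hσr : σ r = -algebraMap F K b - r :=
      (hroots (σ r) (by simpa using congrArg σ hr)).resolve_left hσ
    have hF : {y : F | y ^ 2 + b * y + c = 0} = ∅ := by
      rw [Set.eq_empty_iff_forall_notMem]
      intro y hy
      apply hσ
      rcases hroots (algebraMap F K y) (by simpa using congrArg (algebraMap F K) hy) with h | h
      · simp [← h]
      · have : r = algebraMap F K (-b - y) := by simp [h]
        simp [this]
    have hK : {y : K | y ^ 2 + algebraMap F K b * y + algebraMap F K c = 0 ∧
        σ y = -algebraMap F K b - y} = {r, -algebraMap F K b - r} := by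
      ext y
      simp only [Set.mem_ofPred_eq, Set.mem_insert_iff, Set.mem_singleton_iff]
      constructor
      · exact fun h ↦ hroots y h.1
      · rintro (rfl | rfl)
        · exact ⟨hr, hσr⟩
        · refine ⟨by linear_combination hr, ?_⟩
          simp [hσr]
    rw [hF, hK, Set.ncard_pair fun h ↦ hσ (hσr.trans h.symm), Set.ncard_empty]

namespace WeierstrassCurve.Affine

section Residual

variable {R : Type*} [CommRing R]

/-- The linear coefficient of the monic quadratic polynomial whose roots are the `X`-coordinates
of the residual intersection of a Weierstrass curve with the line of slope `ℓ` through its affine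
point with `X`-coordinate `x₀`. -/
def residualLinearCoeff (W : Affine R) (x₀ ℓ : R) : R :=
  x₀ + W.a₂ - ℓ ^ 2 - W.a₁ * ℓ

/-- The constant coefficient of the monic quadratic polynomial whose roots are the `X`-coordinates
of the residual intersection of a Weierstrass curve with the line of slope `ℓ` through its affine
point `(x₀, y₀)`. -/
def residualConstCoeff (W : Affine R) (x₀ y₀ ℓ : R) : R :=
  2 * x₀ * ℓ ^ 2 + (W.a₁ * x₀ - 2 * y₀ - W.a₃) * ℓ - W.a₁ * y₀ + W.a₄ +
    x₀ * W.residualLinearCoeff x₀ ℓ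

theorem equation_line {W : Affine R} {x₀ y₀ ℓ x : R} (h₀ : W.Equation x₀ y₀)
    (hx : x ^ 2 + W.residualLinearCoeff x₀ ℓ * x + W.residualConstCoeff x₀ y₀ ℓ = 0) :
    W.Equation x (ℓ * (x - x₀) + y₀) := by
  rw [equation_iff'] at h₀ ⊢
  simp only [residualConstCoeff, residualLinearCoeff] at hx
  linear_combination h₀ - (x - x₀) * hx

/-- If a nonvertical line is tangent to a Weierstrass curve at a nonsingular point, then the partial
derivative in `Y` does not vanish there. -/
theorem Nonsingular.polynomialY_ne_zero {W : Affine R} {x y ℓ : R} (h : W.Nonsingular x y)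
    (hℓ : W.a₁ * y - (3 * x ^ 2 + 2 * W.a₂ * x + W.a₄) + ℓ * (2 * y + W.a₁ * x + W.a₃) = 0) :
    2 * y + W.a₁ * x + W.a₃ ≠ 0 := by
  intro hY
  rcases ((nonsingular_iff' ..).mp h).2 with h | h
  · exact h (by linear_combination hℓ - ℓ * hY)
  · exact h hY

end Residual

/-- The two residual intersection points of a line through `P` with an elliptic curve add up to
`-P`. -/
theorem Point.mk_add_mk_eq_neg {k : Type*} [Field k] [DecidableEq k] {W : Affine k}
    [W.IsElliptic] {x₀ y₀ x₁ x₂ y₁ y₂ ℓ : k} (h₀ : W.Equation x₀ y₀) (h₁ : W.Equation x₁ y₁)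
    (h₂ : W.Equation x₂ y₂) (hy₁ : y₁ = ℓ * (x₁ - x₀) + y₀) (hy₂ : y₂ = ℓ * (x₂ - x₀) + y₀)
    (hx₁ : x₁ ^ 2 + W.residualLinearCoeff x₀ ℓ * x₁ + W.residualConstCoeff x₀ y₀ ℓ = 0)
    (hx₂ : x₂ = -W.residualLinearCoeff x₀ ℓ - x₁) :
    Point.mk h₁ + Point.mk h₂ = -Point.mk h₀ := by
  have hdbl (hx : x₁ = x₂) :
      W.a₁ * y₁ - (3 * x₁ ^ 2 + 2 * W.a₂ * x₁ + W.a₄) + ℓ * (2 * y₁ + W.a₁ * x₁ + W.a₃) = 0 := by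
    rw [hx₂] at hx
    simp only [residualConstCoeff, residualLinearCoeff] at hx hx₁
    rw [hy₁]
    linear_combination -hx₁ - (x₁ - x₀) * hx
  have hY (hx : x₁ = x₂) : 2 * y₁ + W.a₁ * x₁ + W.a₃ ≠ 0 :=
    (equation_iff_nonsingular.mp h₁).polynomialY_ne_zero (hdbl hx)
  have hy (hx : x₁ = x₂) : y₁ = y₂ := by rw [hy₁, hy₂, hx]
  have hne (hx : x₁ = x₂) : y₁ ≠ W.negY x₂ y₂ := by
    intro h
    apply hY hx
    rw [← hx, ← hy hx, negY] at h
    linear_combination h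
  have hslope : W.slope x₁ x₂ y₁ y₂ = ℓ := by
    by_cases hx : x₁ = x₂
    · rw [slope_of_Y_ne hx (hne hx), div_eq_iff, negY]
      · linear_combination -hdbl hx
      · intro h
        apply hY hx
        rw [negY] at h
        linear_combination h
    · rw [slope_of_X_ne hx, div_eq_iff (sub_ne_zero.mpr hx)]
      rw [hy₁, hy₂]
      ring
  unfold Point.mk
  rw [Point.add_some fun h ↦ hne h.1 h.2, Point.neg_some, Point.some.injEq, hslope]
  have hX : W.addX x₁ x₂ ℓ = x₀ := by
    rw [addX, hx₂, residualLinearCoeff]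
    ring
  refine ⟨hX, ?_⟩
  rw [addY, negAddY, hX, hy₁]
  ring_nf

section Count

variable {F K : Type*} [Field F] [Field K] [Algebra F K] (E : WeierstrassCurve F)

instance [E.IsElliptic] : (E.baseChange K).IsElliptic :=
  inferInstanceAs (E.map (algebraMap F K)).IsElliptic

theorem baseChange_nonsingular_algebraMap (x y : F) :
    (E.baseChange K).toAffine.Nonsingular (algebraMap F K x) (algebraMap F K y) ↔
      E.toAffine.Nonsingular x y :=
  E.toAffine.map_nonsingular (algebraMap F K).injective x y

variable {E} in
theorem baseChange_equation_algebraMap {x y : F} (h : E.toAffine.Equation x y) :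
    (E.baseChange K).toAffine.Equation (algebraMap F K x) (algebraMap F K y) :=
  h.map (algebraMap F K)

theorem baseChange_residualLinearCoeff (x₀ ℓ : F) :
    (E.baseChange K).toAffine.residualLinearCoeff (algebraMap F K x₀) (algebraMap F K ℓ) =
      algebraMap F K (E.toAffine.residualLinearCoeff x₀ ℓ) := by
  simp [residualLinearCoeff, WeierstrassCurve.baseChange]

theorem baseChange_residualConstCoeff (x₀ y₀ ℓ : F) :
    (E.baseChange K).toAffine.residualConstCoeff (algebraMap F K x₀) (algebraMap F K y₀)
      (algebraMap F K ℓ) = algebraMap F K (E.toAffine.residualConstCoeff x₀ y₀ ℓ) := by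
  simp only [residualConstCoeff, baseChange_residualLinearCoeff]
  simp [WeierstrassCurve.baseChange, map_ofNat (algebraMap F K) 2]

/-- The points of the base change fixed by the involution are those defined over the base field. -/
theorem natCard_fixed_points [DecidableEq K] {σ : K →ₐ[F] K}
    (hfix : ∀ x, σ x = x → ∃ a, algebraMap F K a = x) :
    Nat.card {P : (E.baseChange K).toAffine.Point // Point.map σ P = P} =
      Nat.card E.toAffine.Point := by
  have hinj := (algebraMap F K).injective
  let f : E.toAffine.Point → {P : (E.baseChange K).toAffine.Point // Point.map σ P = P}
    | .zero => ⟨0, map_zero _⟩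
    | .some x y h => ⟨.some _ _ ((baseChange_nonsingular_algebraMap E x y).mpr h), by
        rw [Point.map_some, Point.some.injEq]
        exact ⟨σ.commutes x, σ.commutes y⟩⟩
  refine (Nat.card_congr (Equiv.ofBijective f ⟨?_, ?_⟩)).symm
  · rintro (_ | ⟨x, y, h⟩) (_ | ⟨x', y', h'⟩) hP
    · rfl
    · exact absurd (congrArg Subtype.val hP).symm (Point.some_ne_zero _)
    · exact absurd (congrArg Subtype.val hP) (Point.some_ne_zero _)
    · have := (Point.some.injEq ..).mp (congrArg Subtype.val hP)
      rw [Point.some.injEq]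
      exact ⟨hinj this.1, hinj this.2⟩
  · rintro ⟨_ | ⟨x, y, h⟩, hP⟩
    · exact ⟨.zero, rfl⟩
    · rw [Point.map_some, Point.some.injEq] at hP
      obtain ⟨x, rfl⟩ := hfix x hP.1
      obtain ⟨y, rfl⟩ := hfix y hP.2
      exact ⟨.some x y ((baseChange_nonsingular_algebraMap E x y).mp h), rfl⟩

variable [E.IsElliptic]

theorem finite_point [Finite F] : Finite E.toAffine.Point :=
  .of_equiv (Option {xy : F × F // E.toAffine.Equation xy.1 xy.2}) (pointEquiv E.toAffine).symm

variable [Fintype F]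

theorem natCard_point_eq_sum :
    Nat.card E.toAffine.Point = ∑ x : F, {y : F | y ^ 2 + (E.a₁ * x + E.a₃) * y +
      -(x ^ 3 + E.a₂ * x ^ 2 + E.a₄ * x + E.a₆) = 0}.ncard + 1 := by
  have e : {xy : F × F // E.toAffine.Equation xy.1 xy.2} ≃
      (x : F) × {y : F | y ^ 2 + (E.a₁ * x + E.a₃) * y +
        -(x ^ 3 + E.a₂ * x ^ 2 + E.a₄ * x + E.a₆) = 0} :=
    (Equiv.subtypeEquivRight fun xy ↦ by
      rw [equation_iff']
      constructor <;> intro h <;> linear_combination h).trans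
      (Equiv.subtypeProdEquivSigmaSubtype fun x y : F ↦ y ^ 2 + (E.a₁ * x + E.a₃) * y +
        -(x ^ 3 + E.a₂ * x ^ 2 + E.a₄ * x + E.a₆) = 0)
  rw [Nat.card_congr (pointEquiv E.toAffine), WithZero, Finite.card_option, Nat.card_congr e,
    Nat.card_sigma]
  rfl

/-- The points of the base change on which the involution acts as negation. -/
theorem natCard_antifixed_points_eq_sum [DecidableEq K] [Finite K] {σ : K →ₐ[F] K}
    (hfix : ∀ x, σ x = x → ∃ a, algebraMap F K a = x) :
    Nat.card {P : (E.baseChange K).toAffine.Point // P + Point.map σ P = 0} =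
      ∑ x : F, {y : K | y ^ 2 + algebraMap F K (E.a₁ * x + E.a₃) * y +
        algebraMap F K (-(x ^ 3 + E.a₂ * x ^ 2 + E.a₄ * x + E.a₆)) = 0 ∧
        σ y = -algebraMap F K (E.a₁ * x + E.a₃) - y}.ncard + 1 := by
  let S (x : F) : Set K := {y : K | y ^ 2 + algebraMap F K (E.a₁ * x + E.a₃) * y +
        algebraMap F K (-(x ^ 3 + E.a₂ * x ^ 2 + E.a₄ * x + E.a₆)) = 0 ∧
        σ y = -algebraMap F K (E.a₁ * x + E.a₃) - y}
  have heq (x : F) (y : K) : (E.baseChange K).toAffine.Equation (algebraMap F K x) y ↔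
      y ^ 2 + algebraMap F K (E.a₁ * x + E.a₃) * y +
        algebraMap F K (-(x ^ 3 + E.a₂ * x ^ 2 + E.a₄ * x + E.a₆)) = 0 := by
    rw [equation_iff']
    simp only [WeierstrassCurve.baseChange, map_a₁, map_a₂, map_a₃, map_a₄, map_a₆, map_add,
      map_mul, map_pow, map_neg]
    constructor <;> intro h <;> linear_combination h
  have hneg {x y : K} (h : (E.baseChange K).toAffine.Nonsingular x y) :
      Point.some x y h + Point.map σ (.some x y h) = 0 ↔
        σ x = x ∧ σ y = -y - algebraMap F K E.a₁ * x - algebraMap F K E.a₃ := by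
    rw [add_eq_zero_iff_neg_eq, Point.neg_some, Point.map_some, Point.some.injEq, negY]
    exact and_congr eq_comm eq_comm
  let f : Option ((x : F) × S x) →
      {P : (E.baseChange K).toAffine.Point // P + Point.map σ P = 0}
    | none => ⟨0, by simp⟩
    | some ⟨x, y, hy⟩ => ⟨Point.mk ((heq x y).mpr hy.1), (hneg _).mpr ⟨σ.commutes x, by
        rw [hy.2, map_add, map_mul]
        ring⟩⟩
  have hf : Function.Bijective f := by
    refine ⟨?_, ?_⟩
    · rintro (_ | ⟨x, y, hy⟩) (_ | ⟨x', y', hy'⟩) hP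
      · rfl
      · exact absurd (congrArg Subtype.val hP).symm (Point.some_ne_zero _)
      · exact absurd (congrArg Subtype.val hP) (Point.some_ne_zero _)
      · obtain ⟨hx, rfl⟩ := (Point.some.injEq ..).mp (congrArg Subtype.val hP)
        obtain rfl := (algebraMap F K).injective hx
        rfl
    · rintro ⟨_ | ⟨x, y, h⟩, hP⟩
      · exact ⟨none, rfl⟩
      · obtain ⟨hx, hy⟩ := (hneg h).mp hP
        obtain ⟨x, rfl⟩ := hfix x hx
        refine ⟨some ⟨x, y, (heq x y).mp h.1, ?_⟩, rfl⟩
        rw [hy, map_add, map_mul]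
        ring
  rw [← Nat.card_congr (Equiv.ofBijective f hf), Finite.card_option, Nat.card_sigma]
  rfl

/-- The points over the base field and the antifixed points together number `2q + 2`. -/
theorem natCard_point_add_natCard_antifixed [DecidableEq K] [Finite K] {σ : K →ₐ[F] K}
    (hfix : ∀ x, σ x = x → ∃ a, algebraMap F K a = x)
    (hroot : ∀ b c : F, ∃ r : K, r ^ 2 + algebraMap F K b * r + algebraMap F K c = 0) :
    Nat.card E.toAffine.Point +
      Nat.card {P : (E.baseChange K).toAffine.Point // P + Point.map σ P = 0} =
        2 * Fintype.card F + 2 := by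
  rw [natCard_point_eq_sum, natCard_antifixed_points_eq_sum E hfix, add_add_add_comm,
    ← Finset.sum_add_distrib]
  simp only [ncard_roots_add_ncard_conjugate_roots hfix (hroot _ _), Finset.sum_const,
    Finset.card_univ, smul_eq_mul]
  ring

/-- The lines through a fixed affine point `(x₀, y₀)` partition the points of an elliptic curve:
each residual intersection point lies on a single nonvertical line and differs from the point at
infinity and from `-(x₀, y₀)`. -/
theorem sum_ncard_residual_roots_add_two_le {x₀ y₀ : F} (h₀ : E.toAffine.Equation x₀ y₀) :
    ∑ ℓ : F, {x : F | x ^ 2 + E.toAffine.residualLinearCoeff x₀ ℓ * x +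
      E.toAffine.residualConstCoeff x₀ y₀ ℓ = 0}.ncard + 2 ≤ Nat.card E.toAffine.Point := by
  let S (ℓ : F) : Set F := {x : F | x ^ 2 + E.toAffine.residualLinearCoeff x₀ ℓ * x +
      E.toAffine.residualConstCoeff x₀ y₀ ℓ = 0}
  have hdbl {ℓ : F} (h : x₀ ∈ S ℓ) : E.a₁ * y₀ - (3 * x₀ ^ 2 + 2 * E.a₂ * x₀ + E.a₄) +
      ℓ * (2 * y₀ + E.a₁ * x₀ + E.a₃) = 0 := by
    simp only [S, Set.mem_ofPred_eq, residualConstCoeff, residualLinearCoeff] at h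
    linear_combination -h
  have hY {ℓ : F} (h : x₀ ∈ S ℓ) : 2 * y₀ + E.a₁ * x₀ + E.a₃ ≠ 0 :=
    (equation_iff_nonsingular.mp h₀).polynomialY_ne_zero (hdbl h)
  let f : Option (Option ((ℓ : F) × S ℓ)) → E.toAffine.Point
    | none => 0
    | some none => -Point.mk h₀
    | some (some ⟨_, _, hx⟩) => Point.mk (equation_line h₀ hx)
  have hne (ℓ x : F) (hx : x ∈ S ℓ) : Point.mk (equation_line h₀ hx) ≠ -Point.mk h₀ := by
    intro h
    obtain ⟨rfl, h⟩ := (Point.some.injEq ..).mp h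
    apply hY hx
    rw [negY] at h
    linear_combination h
  have hf : Function.Injective f := by
    rintro (_ | _ | ⟨ℓ, x, hx⟩) (_ | _ | ⟨ℓ', x', hx'⟩) hP
    · rfl
    · exact absurd hP.symm (Point.some_ne_zero _)
    · exact absurd hP.symm (Point.some_ne_zero _)
    · exact absurd hP (Point.some_ne_zero _)
    · rfl
    · exact absurd hP.symm (hne _ _ hx')
    · exact absurd hP (Point.some_ne_zero _)
    · exact absurd hP (hne _ _ hx)
    · obtain ⟨rfl, hy⟩ := (Point.some.injEq ..).mp hP
      obtain rfl : ℓ = ℓ' := by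
        by_cases hx₀ : x = x₀
        · subst hx₀
          exact mul_right_cancel₀ (hY hx) (by linear_combination hdbl hx - hdbl hx')
        · exact mul_right_cancel₀ (sub_ne_zero.mpr hx₀) (by linear_combination hy)
      rfl
  have := finite_point E
  have hcard := Nat.card_le_card_of_injective f hf
  rw [Finite.card_option, Finite.card_option, Nat.card_sigma] at hcard
  exact hcard

/-- Every point fixed by the involution is the sum of a point and its conjugate. -/
theorem exists_add_map_eq [DecidableEq K] [Finite K] {σ : K →ₐ[F] K}
    (hfix : ∀ x, σ x = x → ∃ a, algebraMap F K a = x)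
    (hroot : ∀ b c : F, ∃ r : K, r ^ 2 + algebraMap F K b * r + algebraMap F K c = 0)
    (R : (E.baseChange K).toAffine.Point) (hR : Point.map σ R = R) :
    ∃ P : (E.baseChange K).toAffine.Point, P + Point.map σ P = R := by
  by_cases hR0 : R = 0
  · exact ⟨0, by simp [hR0]⟩
  obtain ⟨x₀, y₀, h₀, hR₀⟩ : ∃ (x₀ y₀ : F) (h₀ : E.toAffine.Equation x₀ y₀),
      -R = Point.mk (baseChange_equation_algebraMap h₀) := by
    have hN : Point.map σ (-R) = -R := by rw [map_neg, hR]
    have hN0 : -R ≠ 0 := neg_ne_zero.mpr hR0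
    generalize -R = N at hN hN0
    rcases N with _ | ⟨x, y, h⟩
    · exact absurd rfl hN0
    · rw [Point.map_some, Point.some.injEq] at hN
      obtain ⟨x, rfl⟩ := hfix x hN.1
      obtain ⟨y, rfl⟩ := hfix y hN.2
      exact ⟨x, y, ((baseChange_nonsingular_algebraMap E x y).mp h).1, rfl⟩
  by_contra! hno
  have hcard (ℓ : F) : {x : F | x ^ 2 + E.toAffine.residualLinearCoeff x₀ ℓ * x +
      E.toAffine.residualConstCoeff x₀ y₀ ℓ = 0}.ncard = 2 := by
    have htwo := ncard_roots_add_ncard_conjugate_roots hfix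
      (hroot (E.toAffine.residualLinearCoeff x₀ ℓ) (E.toAffine.residualConstCoeff x₀ y₀ ℓ))
    have hempty : {x : K | x ^ 2 + algebraMap F K (E.toAffine.residualLinearCoeff x₀ ℓ) * x +
        algebraMap F K (E.toAffine.residualConstCoeff x₀ y₀ ℓ) = 0 ∧
        σ x = -algebraMap F K (E.toAffine.residualLinearCoeff x₀ ℓ) - x} = ∅ := by
      rw [Set.eq_empty_iff_forall_notMem]
      rintro x ⟨hx, hσx⟩
      rw [← baseChange_residualLinearCoeff] at hx hσx
      rw [← baseChange_residualConstCoeff] at hx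
      have h := equation_line (baseChange_equation_algebraMap h₀) hx
      refine hno (Point.mk h) ?_
      rw [← neg_neg R, hR₀]
      exact Point.mk_add_mk_eq_neg _ h
        (equation_iff_nonsingular.mpr
          ((E.toAffine.baseChange_nonsingular σ.injective _ _).mpr (equation_iff_nonsingular.mp h)))
        rfl (by simp) hx hσx
    rw [hempty, Set.ncard_empty] at htwo
    exact htwo
  have hle := sum_ncard_residual_roots_add_two_le E h₀
  have hsum := natCard_point_add_natCard_antifixed E hfix hroot
  have : Nonempty {P : (E.baseChange K).toAffine.Point // P + Point.map σ P = 0} :=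
    ⟨0, by simp⟩
  have := finite_point (E.baseChange K)
  have : 0 < Nat.card {P : (E.baseChange K).toAffine.Point // P + Point.map σ P = 0} :=
    Nat.card_pos
  simp only [hcard, Finset.sum_const, Finset.card_univ, smul_eq_mul] at hle
  omega

end Count

end WeierstrassCurve.Affine

/-- Let `E` be an elliptic curve (a Weierstrass curve with nonvanishing
discriminant) over a finite field `F` with `q` elements and let `K` be a field extension
of `F` of degree `2`.  If `N = |E(F)|` and `N' = |E(K)|` then `N' = N·(2q + 2 − N)`. -/
theorem card_points_quadratic_extension {F : Type*} [Field F] [Fintype F]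
    {K : Type*} [Field K] [Algebra F K] (hK : Module.finrank F K = 2)
    (E : WeierstrassCurve F) (hΔ : E.Δ ≠ 0) :
    (Nat.card (E.baseChange K).toAffine.Point : ℤ) =
      (Nat.card E.toAffine.Point : ℤ) *
        (2 * (Fintype.card F : ℤ) + 2 - (Nat.card E.toAffine.Point : ℤ)) := by
  classical
  have : E.IsElliptic := ⟨hΔ.isUnit⟩
  have : FiniteDimensional F K := Module.finite_of_finrank_pos (by omega)
  have : Finite K := Module.finite_of_finite F
  obtain ⟨σ, hσ, hfix⟩ := exists_involution_of_finrank_eq_two hK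
  have hroot := exists_root_of_finrank_eq_two hK
  let S : (E.baseChange K).toAffine.Point →+ (E.baseChange K).toAffine.Point :=
    WeierstrassCurve.Affine.Point.map σ
  let ν := AddMonoidHom.id _ + S
  have hS (P) : S (S P) = P := by
    rcases P with _ | ⟨x, y, h⟩
    · rfl
    · simp only [S]
      rw [WeierstrassCurve.Affine.Point.map_some, WeierstrassCurve.Affine.Point.map_some,
        WeierstrassCurve.Affine.Point.some.injEq]
      exact ⟨hσ x, hσ y⟩
  have hrange (R) : R ∈ ν.range ↔ S R = R := by
    refine ⟨?_, WeierstrassCurve.Affine.exists_add_map_eq E hfix hroot R⟩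
    rintro ⟨P, rfl⟩
    simp [ν, hS, add_comm]
  have hker (P) : P ∈ ν.ker ↔ P + S P = 0 := Iff.rfl
  have hcard : Nat.card (E.baseChange K).toAffine.Point =
      Nat.card ν.range * Nat.card ν.ker := by
    rw [← AddSubgroup.index_ker, mul_comm, AddSubgroup.card_mul_index]
  rw [Nat.card_congr (Equiv.subtypeEquivRight hrange),
    Nat.card_congr (Equiv.subtypeEquivRight hker),
    WeierstrassCurve.Affine.natCard_fixed_points E hfix] at hcard
  have hsum := WeierstrassCurve.Affine.natCard_point_add_natCard_antifixed E hfix hroot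
  rw [hcard, Nat.cast_mul]
  congr 1
  rw [eq_sub_iff_add_eq', ← Nat.cast_add, hsum]
  simp
end

section
/- Let E be an elliptic curve over a finite field F_q with q elements, where q ≡ −1 (mod 3), and suppose that 3 does not divide N = |E(F_q)|. Let K be a field extension of F_q of degree 2. Then |E(K)| ≡ −1 (mod 3). -/
section FieldExtension

variable {F K : Type*} [Field F] [Field K] [Algebra F K]

/-- A quadratic extension of finite fields has an involution whose fixed field is `F`, and every
monic quadratic polynomial `X² - b X + c` over `F` either splits over `F` or has a pair of distinct
conjugate roots in `K`. -/
theorem exists_conj_of_finrank_eq_two [Finite F] (hK : Module.finrank F K = 2) :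
    ∃ σ : K →ₐ[F] K, (∀ x, σ (σ x) = x) ∧ (∀ x, σ x = x → ∃ a, algebraMap F K a = x) ∧
      ∀ b c : F, (∃ r s : F, r + s = b ∧ r * s = c) ∨
        ∃ r : K, σ r ≠ r ∧ r + σ r = algebraMap F K b ∧ r * σ r = algebraMap F K c := by
  have : FiniteDimensional F K := Module.finite_of_finrank_pos (by omega)
  have : Finite K := Module.finite_of_finite F
  have hcard : Nat.card Gal(K/F) = 2 := (IsGalois.card_aut_eq_finrank F K).trans hK
  obtain ⟨σ, -, huniq⟩ := (Nat.card_eq_two_iff' (1 : Gal(K/F))).mp hcard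
  have hfix : ∀ x, σ x = x → ∃ a, algebraMap F K a = x := fun x hx ↦
    (IsGalois.mem_range_algebraMap_iff_fixed x).mpr fun τ ↦ by
      rcases (em (τ = 1)).imp_right (huniq τ) with rfl | rfl
      · rfl
      · exact hx
  have hinv : ∀ x, σ (σ x) = x := fun x ↦ by
    have h : σ ^ 2 = 1 := hcard ▸ pow_card_eq_one'
    simpa [pow_two] using congr($h x)
  refine ⟨σ, hinv, hfix, fun b c ↦ ?_⟩
  have hroot : ∃ r : K, r ^ 2 - algebraMap F K b * r + algebraMap F K c = 0 := by
    let p : Polynomial F := .X ^ 2 - .C b * .X + .C c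
    have hdeg : p.natDegree = 2 := by simp only [p]; compute_degree!
    by_cases h : ∃ x, p.IsRoot x
    · obtain ⟨x, hx⟩ := h
      refine ⟨algebraMap F K x, ?_⟩
      simpa [p] using congrArg (algebraMap F K) hx
    · have hirr : Irreducible p := Polynomial.irreducible_of_degree_le_three_of_not_isRoot
        (by simp [hdeg]) (by simpa using h)
      have := Fact.mk hirr
      have hfin : Module.finrank F (AdjoinRoot p) = 2 := by
        rw [(AdjoinRoot.powerBasis hirr.ne_zero).finrank, AdjoinRoot.powerBasis_dim, hdeg]
      obtain ⟨f⟩ := FiniteField.nonempty_algHom_of_finrank_dvd (F := F) (K := AdjoinRoot p) (L := K)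
        (by rw [hfin, hK])
      refine ⟨f (AdjoinRoot.root p), ?_⟩
      have hf : Polynomial.aeval (f (AdjoinRoot.root p)) p = 0 := by
        rw [Polynomial.aeval_algHom_apply, AdjoinRoot.aeval_eq, AdjoinRoot.mk_self, map_zero]
      generalize f (AdjoinRoot.root p) = r at hf
      simpa [p] using hf
  obtain ⟨r, hr⟩ := hroot
  by_cases hσ : σ r = r
  · obtain ⟨a, rfl⟩ := hfix r hσ
    refine .inl ⟨a, b - a, by ring, (algebraMap F K).injective ?_⟩
    simp only [map_mul, map_sub]
    linear_combination -hr
  · have hr' := congrArg σ hr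
    simp only [map_add, map_sub, map_mul, map_pow, map_zero, AlgEquiv.commutes] at hr'
    have hsum : r + σ r = algebraMap F K b :=
      mul_left_cancel₀ (sub_ne_zero.mpr hσ) (by linear_combination hr' - hr)
    exact .inr ⟨r, hσ, hsum, show r * σ r = _ by linear_combination r * hsum - hr⟩

/-- A quadratic polynomial `X² - b X + c` over `F` has two roots in total, counting its roots in `F`
and its roots in `K` whose conjugate is the other root. -/
theorem card_roots_add_card_conj_roots {σ : K →ₐ[F] K} (hinv : ∀ x, σ (σ x) = x)
    {b c : F} (h : (∃ r s : F, r + s = b ∧ r * s = c) ∨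
        ∃ r : K, σ r ≠ r ∧ r + σ r = algebraMap F K b ∧ r * σ r = algebraMap F K c) :
    Nat.card {y : F // y * (b - y) = c} +
      Nat.card {y : K // y + σ y = algebraMap F K b ∧ y * σ y = algebraMap F K c} = 2 := by
  rcases h with ⟨r, s, rfl, rfl⟩ | ⟨r, hr, hb, hc⟩
  · have h₁ : {y : F | y * (r + s - y) = r * s} = {r, s} := by
      ext y
      simp only [Set.mem_ofPred_eq, Set.mem_insert_iff, Set.mem_singleton_iff]
      rw [← sub_eq_zero (a := y), ← sub_eq_zero (a := y) (b := s), ← mul_eq_zero]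
      constructor <;> intro h <;> linear_combination -h
    have h₂ : ∀ y : K, (y + σ y = algebraMap F K (r + s) ∧ y * σ y = algebraMap F K (r * s)) ↔
        r = s ∧ y = algebraMap F K r := by
      refine fun y ↦ ⟨fun ⟨h, h'⟩ ↦ ?_, ?_⟩
      · rw [map_add] at h
        rw [map_mul] at h'
        have : (y - algebraMap F K r) * (y - algebraMap F K s) = 0 := by
          linear_combination y * h - h'
        rcases mul_eq_zero.mp this with h₀ | h₀ <;> rw [sub_eq_zero] at h₀ <;> subst h₀ <;>
          rw [AlgHom.commutes] at h
        · have := (algebraMap F K).injective (add_left_cancel h)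
          exact ⟨this, rfl⟩
        · have := (algebraMap F K).injective (add_right_cancel h)
          exact ⟨this.symm, congrArg _ this⟩
      · rintro ⟨rfl, rfl⟩
        simp
    have e₁ : Nat.card {y : F // y * (r + s - y) = r * s} = ({r, s} : Set F).ncard := by
      rw [← h₁]; rfl
    rw [e₁, Nat.card_congr (Equiv.subtypeEquivRight h₂)]
    by_cases hrs : r = s
    · subst hrs; simp
    · simp [hrs, Set.ncard_pair hrs]
  · have h₁ : IsEmpty {y : F // y * (b - y) = c} := by
      refine ⟨fun ⟨y, hy⟩ ↦ hr ?_⟩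
      have hy := congrArg (algebraMap F K) hy
      simp only [map_mul, map_sub] at hy
      have : (algebraMap F K y - r) * (algebraMap F K y - σ r) = 0 := by
        linear_combination -hy - algebraMap F K y * hb + hc
      rcases mul_eq_zero.mp this with h₀ | h₀ <;> rw [sub_eq_zero] at h₀
      · rw [← h₀, AlgHom.commutes]
      · rw [← hinv r, ← h₀, AlgHom.commutes, AlgHom.commutes]
    have h₂ : {y : K | y + σ y = algebraMap F K b ∧ y * σ y = algebraMap F K c} = {r, σ r} := by
      ext y
      simp only [Set.mem_ofPred_eq, Set.mem_insert_iff, Set.mem_singleton_iff]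
      refine ⟨fun ⟨h, h'⟩ ↦ ?_, ?_⟩
      · rw [← sub_eq_zero (a := y), ← sub_eq_zero (a := y) (b := σ r), ← mul_eq_zero]
        linear_combination y * h - h' - y * hb + hc
      · rintro (rfl | rfl)
        · exact ⟨hb, hc⟩
        · rw [hinv, add_comm, mul_comm]
          exact ⟨hb, hc⟩
    have e₂ : Nat.card {y : K // y + σ y = algebraMap F K b ∧ y * σ y = algebraMap F K c} =
        ({r, σ r} : Set K).ncard := by
      rw [← h₂]; rfl
    rw [Nat.card_of_isEmpty, e₂, Set.ncard_pair (Ne.symm hr)]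

end FieldExtension

namespace WeierstrassCurve.Affine

section Line

variable {L : Type*} [Field L] {W : Affine L}

/-- `r` and `s` are the abscissas of the other two intersection points of `W` with the line of slope
`l` through the point `(x, y)` of `W`. -/
structure IsResidual (W : Affine L) (x y l r s : L) : Prop where
  add_eq : r + s = l ^ 2 + W.a₁ * l - W.a₂ - x
  mul_eq : r * s = W.a₄ - 2 * l * (y - l * x) - W.a₁ * (y - l * x) - W.a₃ * l -
    x * (l ^ 2 + W.a₁ * l - W.a₂ - x)

namespace IsResidual

variable {x y l r s : L}

theorem symm (h : W.IsResidual x y l r s) : W.IsResidual x y l s r :=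
  ⟨add_comm s r ▸ h.add_eq, mul_comm s r ▸ h.mul_eq⟩

theorem equation (h : W.IsResidual x y l r s) (hxy : W.Equation x y) :
    W.Equation r (l * (r - x) + y) := by
  rw [equation_iff] at hxy ⊢
  linear_combination hxy + (r - x) * (h.mul_eq - r * h.add_eq)

theorem slope_eq [DecidableEq L] (h : W.IsResidual x y l r s) (hxy : W.Nonsingular x y) :
    ¬(r = x ∧ l * (r - x) + y = W.negY x y) ∧ W.slope r x (l * (r - x) + y) y = l := by
  by_cases hr : r = x
  · subst hr
    have hd : l * (y - W.negY r y) = 3 * r ^ 2 + 2 * W.a₂ * r + W.a₄ - W.a₁ * y := by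
      rw [negY]
      linear_combination h.mul_eq - r * h.add_eq
    have hy : y ≠ W.negY r y := by
      intro hy
      rw [← hy, sub_self, mul_zero] at hd
      rw [negY] at hy
      rcases ((nonsingular_iff' ..).mp hxy).2 with h' | h'
      · exact h' (by linear_combination hd)
      · exact h' (by linear_combination hy)
    simp only [sub_self, mul_zero, zero_add, true_and]
    exact ⟨hy, by rw [slope_of_Y_ne rfl hy, div_eq_iff (sub_ne_zero.mpr hy), hd]⟩
  · refine ⟨fun h ↦ hr h.1, ?_⟩
    rw [slope_of_X_ne hr, add_sub_cancel_right, mul_div_cancel_right₀ _ (sub_ne_zero.mpr hr)]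

theorem some_add_some [DecidableEq L] (h : W.IsResidual x y l r s) (hxy : W.Nonsingular x y)
    (hr : W.Nonsingular r (l * (r - x) + y)) (hs : W.Nonsingular s (l * (s - x) + y)) :
    Point.some _ _ hr + Point.some _ _ hs = -Point.some _ _ hxy := by
  obtain ⟨hne, hl⟩ := h.slope_eq hxy
  have hX : W.addX r x l = s := by
    rw [addX]
    linear_combination -h.add_eq
  have : Point.some _ _ hr + Point.some _ _ hxy = -Point.some _ _ hs := by
    rw [Point.add_some hne, Point.neg_some, Point.some.injEq, addY, negAddY, hl, hX]
    refine ⟨rfl, ?_⟩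
    congr 1
    ring
  rw [eq_neg_iff_add_eq_zero, add_right_comm, this, neg_add_cancel]

end IsResidual

end Line

section QuadraticExtension

variable {F K : Type*} [Field F] [Field K] [Algebra F K] {σ : K →ₐ[F] K}
  (E : Affine F)

theorem some_add_map_some_eq_zero_iff [DecidableEq K] {x y : K} (h : (E⁄K).Nonsingular x y) :
    Point.some x y h + Point.map σ (Point.some x y h) = 0 ↔ σ x = x ∧ σ y = (E⁄K).negY x y := by
  rw [Point.map_some, add_eq_zero_iff_neg_eq, Point.neg_some, Point.some.injEq, eq_comm, eq_comm (a := negY ..)]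

variable [E.IsElliptic]

instance isElliptic_baseChange : (E⁄K).IsElliptic :=
  inferInstanceAs (E.map (algebraMap F K)).IsElliptic

theorem card_point_eq_sum [Fintype F] : Nat.card E.Point =
    ∑ x : F, Nat.card {y : F // y * (-(E.a₁ * x + E.a₃) - y) =
      -(x ^ 3 + E.a₂ * x ^ 2 + E.a₄ * x + E.a₆)} + 1 := by
  have e : ∀ xy : F × F, E.Equation xy.1 xy.2 ↔
      xy.2 * (-(E.a₁ * xy.1 + E.a₃) - xy.2) =
        -(xy.1 ^ 3 + E.a₂ * xy.1 ^ 2 + E.a₄ * xy.1 + E.a₆) := fun xy ↦ by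
    rw [equation_iff]
    constructor <;> intro h <;> linear_combination -h
  rw [Nat.card_congr (pointEquiv E), ← Nat.card_sigma,
    ← Nat.card_congr (Equiv.subtypeProdEquivSigmaSubtype fun x y ↦ _ = _),
    ← Nat.card_congr (Equiv.subtypeEquivRight e)]
  exact Finite.card_option

theorem card_add_map_eq_zero_eq_sum [Fintype F] [Finite K] [DecidableEq K]
    (hfix : ∀ x, σ x = x → ∃ a, algebraMap F K a = x) :
    Nat.card {Q : (E⁄K).Point // Q + Point.map σ Q = 0} =
      ∑ x : F, Nat.card {y : K // y + σ y = algebraMap F K (-(E.a₁ * x + E.a₃)) ∧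
        y * σ y = algebraMap F K (-(x ^ 3 + E.a₂ * x ^ 2 + E.a₄ * x + E.a₆))} + 1 := by
  rw [← Nat.card_sigma, ← Finite.card_option,
    Nat.card_congr (pointEquivSubtype (by exact add_zero 0))]
  symm
  refine Nat.card_congr (Equiv.optionCongr (Equiv.ofBijective (fun p ↦
    ⟨(algebraMap F K p.1, p.2.1), ?_, ?_⟩) ⟨?_, ?_⟩))
  · obtain ⟨x, y, h, h'⟩ := p
    simp only [map_neg, map_add, map_mul, map_pow] at h h'
    simp only [equation_iff, baseChange_a₁, baseChange_a₂, baseChange_a₃, baseChange_a₄, baseChange_a₆]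
    linear_combination y * h - h'
  · obtain ⟨x, y, h, h'⟩ := p
    simp only [map_neg, map_add, map_mul, map_pow] at h h'
    refine (some_add_map_some_eq_zero_iff E _).mpr ⟨σ.commutes _, ?_⟩
    simp only [negY, baseChange_a₁, baseChange_a₃]
    linear_combination h
  · rintro ⟨x, y, h⟩ ⟨x', y', h'⟩ hxy
    simp only [Subtype.mk.injEq, Prod.mk.injEq] at hxy
    obtain ⟨hx, rfl⟩ := hxy
    obtain rfl := (algebraMap F K).injective hx
    rfl
  · rintro ⟨⟨x, y⟩, h, h'⟩
    obtain ⟨hx, hy⟩ := (some_add_map_some_eq_zero_iff E _).mp h'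
    obtain ⟨x, rfl⟩ := hfix _ hx
    simp only [equation_iff, negY, baseChange_a₁, baseChange_a₂, baseChange_a₃, baseChange_a₄, baseChange_a₆] at h hy
    refine ⟨⟨x, y, ?_, ?_⟩, rfl⟩
    · simp only [map_neg, map_add, map_mul]
      linear_combination hy
    · simp only [map_neg, map_add, map_mul, map_pow]
      linear_combination y * hy - h

/-- The numbers of points of `E` and of its quadratic twist, the latter being identified with the
points of `E` over `K` on which the conjugation acts as `-1`, add up to `2 (q + 1)`. -/
theorem card_add_card_add_map_eq_zero [Fintype F] [Finite K] [DecidableEq K]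
    (hinv : ∀ x, σ (σ x) = x) (hfix : ∀ x, σ x = x → ∃ a, algebraMap F K a = x)
    (hquad : ∀ b c : F, (∃ r s : F, r + s = b ∧ r * s = c) ∨
      ∃ r : K, σ r ≠ r ∧ r + σ r = algebraMap F K b ∧ r * σ r = algebraMap F K c) :
    Nat.card E.Point + Nat.card {Q : (E⁄K).Point // Q + Point.map σ Q = 0} =
      2 * (Fintype.card F + 1) := by
  rw [card_point_eq_sum, card_add_map_eq_zero_eq_sum E hfix, add_add_add_comm,
    ← Finset.sum_add_distrib,
    Finset.sum_congr rfl fun x _ ↦ card_roots_add_card_conj_roots hinv (hquad _ _)]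
  simp
  ring

/-- Every rational point `P` is the trace of a point over `K`: otherwise each line through `-P`
would meet `E` in two further distinct rational points, and `E` would have too many points. -/
theorem exists_add_map_eq_baseChange [Fintype F] [Finite K] [DecidableEq F] [DecidableEq K]
    (hinv : ∀ x, σ (σ x) = x) (hfix : ∀ x, σ x = x → ∃ a, algebraMap F K a = x)
    (hquad : ∀ b c : F, (∃ r s : F, r + s = b ∧ r * s = c) ∨
      ∃ r : K, σ r ≠ r ∧ r + σ r = algebraMap F K b ∧ r * σ r = algebraMap F K c)
    (P : (E⁄F).Point) : ∃ Q : (E⁄K).Point, Q + Point.map σ Q = Point.baseChange F K P := by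
  obtain ⟨S, rfl⟩ : ∃ S, P = -S := ⟨-P, (neg_neg P).symm⟩
  rcases S with _ | ⟨x, y, hxy⟩
  · exact ⟨0, by simp [← Point.zero_def]⟩
  by_contra! hQ
  have hpair (l : F) : ∃ r s : F, r ≠ s ∧ (E⁄F).IsResidual x y l r s := by
    obtain ⟨r, s, h₁, h₂⟩ | ⟨r, hr, h₁, h₂⟩ := hquad
      (l ^ 2 + E.a₁ * l - E.a₂ - x)
      (E.a₄ - 2 * l * (y - l * x) - E.a₁ * (y - l * x) - E.a₃ * l -
        x * (l ^ 2 + E.a₁ * l - E.a₂ - x))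
    · have h : (E⁄F).IsResidual x y l r s := ⟨h₁, h₂⟩
      refine ⟨r, s, ?_, h⟩
      rintro rfl
      have hr := equation_iff_nonsingular.mp (h.equation hxy.1)
      refine hQ (Point.baseChange F K (Point.some _ _ hr)) ?_
      rw [Point.map_baseChange, ← map_add, h.some_add_some hxy hr hr]
    · have hxy' := (E.baseChange_nonsingular (Algebra.ofId F K).injective x y).mpr hxy
      have h : (E⁄K).IsResidual (algebraMap F K x) (algebraMap F K y) (algebraMap F K l) r (σ r) :=
        ⟨by simpa using h₁, by simpa [map_ofNat] using h₂⟩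
      have hr := equation_iff_nonsingular.mp (h.equation hxy'.1)
      have hs := equation_iff_nonsingular.mp (h.symm.equation hxy'.1)
      refine (hQ (Point.some _ _ hr) ?_).elim
      rw [map_neg, Point.map_some, Point.map_some]
      refine Eq.trans ?_ (h.some_add_some hxy' hr hs)
      congr 2
      simp
  have hcard : 2 * Fintype.card (Option F) ≤ Nat.card (E⁄F).Point := by
    classical
    have : Finite (E⁄F).Point := .of_equiv (Option {xy : F × F // (E⁄F).Equation xy.1 xy.2})
      (pointEquiv (E⁄F)).symm
    have := Fintype.ofFinite (E⁄F).Point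
    let φ : (E⁄F).Point → Option F := fun Q ↦ match Q with
      | .zero => none
      | .some u v _ => if u = x ∧ v = (E⁄F).negY x y then none else .some ((E⁄F).slope u x v y)
    by_contra! hlt
    rw [Nat.card_eq_fintype_card, mul_comm] at hlt
    obtain ⟨l, hl⟩ := Fintype.exists_card_fiber_lt_of_card_lt_mul φ hlt
    refine hl.not_ge (Finset.one_lt_card.mpr ?_)
    simp only [Finset.mem_filter_univ]
    cases l with
    | none => exact ⟨0, rfl, -Point.some x y hxy, if_pos ⟨rfl, rfl⟩,
        (neg_ne_zero.mpr (Point.some_ne_zero hxy)).symm⟩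
    | some l =>
      obtain ⟨r, s, hne, h⟩ := hpair l
      have mem {r s : F} (h : (E⁄F).IsResidual x y l r s) (hr) :
          φ (.some r (l * (r - x) + y) hr) = .some l := by
        obtain ⟨h₁, h₂⟩ := h.slope_eq hxy
        exact (if_neg h₁).trans (congrArg _ h₂)
      have hr := equation_iff_nonsingular.mp (h.equation hxy.1)
      have hs := equation_iff_nonsingular.mp (h.symm.equation hxy.1)
      exact ⟨.some _ _ hr, mem h hr, .some _ _ hs, mem h.symm hs,
        fun heq ↦ hne (Point.some.inj heq).1⟩
  have htwist := card_add_card_add_map_eq_zero E hinv hfix hquad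
  rw [card_add_map_eq_zero_eq_sum E hfix] at htwist
  rw [Fintype.card_option] at hcard
  change _ ≤ Nat.card E.Point at hcard
  omega

/-- The group of points over `K` is an extension of the group of rational points by that of the
quadratic twist. -/
theorem card_baseChange_eq_mul [Fintype F] [Finite K] [DecidableEq K]
    (hinv : ∀ x, σ (σ x) = x) (hfix : ∀ x, σ x = x → ∃ a, algebraMap F K a = x)
    (hquad : ∀ b c : F, (∃ r s : F, r + s = b ∧ r * s = c) ∨
      ∃ r : K, σ r ≠ r ∧ r + σ r = algebraMap F K b ∧ r * σ r = algebraMap F K c) :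
    Nat.card (E⁄K).Point =
      Nat.card E.Point * Nat.card {Q : (E⁄K).Point // Q + Point.map σ Q = 0} := by
  classical
  let tr : (E⁄K).Point →+ (E⁄K).Point := AddMonoidHom.id _ + Point.map σ
  have hrange : (tr.range : Set (E⁄K).Point) = Set.range (Point.baseChange (W' := E) F K) := by
    refine subset_antisymm ?_ ?_
    · rintro _ ⟨Q, rfl⟩
      have hσ : Point.map σ (tr Q) = tr Q := by
        have : Point.map σ (Point.map σ Q) = Q := by
          rcases Q with _ | ⟨x, y, h⟩
          · rfl
          · simp [Point.map_some, hinv]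
        change Point.map σ (Q + Point.map σ Q) = Q + Point.map σ Q
        rw [map_add, this, add_comm]
      generalize tr Q = R at hσ
      rcases R with _ | ⟨x, y, h⟩
      · exact ⟨0, rfl⟩
      · rw [Point.map_some, Point.some.injEq] at hσ
        obtain ⟨x, rfl⟩ := hfix x hσ.1
        obtain ⟨y, rfl⟩ := hfix y hσ.2
        exact ⟨.some x y ((baseChange_nonsingular E (Algebra.ofId F K).injective x y).mp h), rfl⟩
    · rintro _ ⟨P, rfl⟩
      exact exists_add_map_eq_baseChange E hinv hfix hquad P
  have hcard : Nat.card tr.range = Nat.card E.Point := by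
    rw [← SetLike.coe_sort_coe, hrange]
    exact Nat.card_range_of_injective (Point.map_injective (W' := E) (Algebra.ofId F K))
  rw [← tr.ker.index_mul_card, AddSubgroup.index_ker, hcard]
  rfl

end QuadraticExtension

end WeierstrassCurve.Affine

/-- Let `E` be an elliptic curve (a Weierstrass curve with nonvanishing
discriminant) over a finite field `F` with `q` elements, where `q ≡ −1 (mod 3)`, and
suppose that `3` does not divide `N = |E(F)|`.  If `K` is a field extension of `F` of
degree `2`, then `|E(K)| ≡ −1 (mod 3)`. -/
theorem card_points_quadratic_extension_mod_three {F : Type*} [Field F] [Fintype F]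
    {K : Type*} [Field K] [Algebra F K] (hK : Module.finrank F K = 2)
    (E : WeierstrassCurve F) (hΔ : E.Δ ≠ 0)
    (hq : (Fintype.card F : ℤ) ≡ -1 [ZMOD 3])
    (hN : ¬ (3 : ℕ) ∣ Nat.card E.toAffine.Point) :
    (Nat.card (E.baseChange K).toAffine.Point : ℤ) ≡ -1 [ZMOD 3] := by
  classical
  have : E.IsElliptic := ⟨isUnit_iff_ne_zero.mpr hΔ⟩
  have : FiniteDimensional F K := Module.finite_of_finrank_pos (by omega)
  have : Finite K := Module.finite_of_finite F
  obtain ⟨σ, hinv, hfix, hquad⟩ := exists_conj_of_finrank_eq_two hK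
  have hsum := WeierstrassCurve.Affine.card_add_card_add_map_eq_zero E hinv hfix hquad
  have hmul : Nat.card (E.baseChange K).toAffine.Point = _ :=
    WeierstrassCurve.Affine.card_baseChange_eq_mul E hinv hfix hquad
  rw [hmul]
  set N := Nat.card E.toAffine.Point
  set M := Nat.card {Q : (WeierstrassCurve.Affine.baseChange E K).Point //
    Q + WeierstrassCurve.Affine.Point.map σ Q = 0}
  have hM : (M : ℤ) ≡ -N [ZMOD 3] := by
    simp only [Int.ModEq] at hq ⊢
    omega
  have hN' : (N : ℤ) ^ 2 ≡ 1 [ZMOD 3] :=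
    Int.ModEq.pow_card_sub_one_eq_one Nat.prime_three
      (Nat.isCoprime_iff_coprime.mpr ((Nat.Prime.coprime_iff_not_dvd Nat.prime_three).mpr hN).symm)
  calc ((N * M : ℕ) : ℤ) = N * M := by push_cast; rfl
    _ ≡ N * -N [ZMOD 3] := hM.mul_left _
    _ = -(N : ℤ) ^ 2 := by ring
    _ ≡ -1 [ZMOD 3] := hN'.neg
end
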